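/- arXiv:2310.17713 — 6 statements merged into one kernel-verified Lean document; each statement's English description precedes it below -/
import Mathlib

section
/- Let $S_1$ and $S_2$ be Puiseux monoids. The reduced finitary power monoids $\mathcal P_{\mathrm{fin},0}(S_1)$ and $\mathcal P_{\mathrm{fin},0}(S_2)$ are isomorphic as monoids if and only if $S_1$ and $S_2$ are isomorphic as (additive) monoids. -/
open scoped Pointwise NNRat

/-- The reduced finitary power monoid of an additive monoid `M`: the finite subsets of `M`
containing `0`, under setwise addition, viewed as an additive submonoid of `Finset M`. -/
def RFPM (M : Type*) [AddCommMonoid M] [DecidableEq M] : AddSubmonoid (Finset M) where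
  carrier := {X | (0 : M) ∈ X}
  zero_mem' := Finset.zero_mem_zero
  add_mem' := fun h1 h2 => by simpa using Finset.add_mem_add h1 h2

namespace RFPM

/-- An isomorphism of additive monoids induces one of reduced finitary power monoids. -/
def congr {M N : Type*} [AddCommMonoid M] [DecidableEq M] [AddCommMonoid N] [DecidableEq N]
    (e : M ≃+ N) : RFPM M ≃+ RFPM N where
  toFun X := ⟨X.1.image e, Finset.mem_image.2 ⟨0, X.2, map_zero e⟩⟩
  invFun Y := ⟨Y.1.image e.symm, Finset.mem_image.2 ⟨0, Y.2, map_zero e.symm⟩⟩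
  left_inv X := Subtype.ext <| by simp [Finset.image_image]
  right_inv Y := Subtype.ext <| by simp [Finset.image_image]
  map_add' X Y := Subtype.ext <| Finset.image_add e

/-- The element `{0, a}` of the reduced finitary power monoid. -/
def pair {M : Type*} [AddCommMonoid M] [DecidableEq M] (a : M) : RFPM M :=
  ⟨{0, a}, Finset.mem_insert_self 0 {a}⟩

end RFPM

/-- An element of an `n`-fold sumset is the sum of a multiset of `n` elements. -/
theorem Finset.exists_multiset_of_mem_nsmul {M : Type*} [AddCommMonoid M] [DecidableEq M]
    {A : Finset M} {n : ℕ} {y : M} (hy : y ∈ n • A) :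
    ∃ s : Multiset M, s.card = n ∧ (∀ x ∈ s, x ∈ A) ∧ s.sum = y := by
  induction n generalizing y with
  | zero => exact ⟨0, by simp_all⟩
  | succ n ih =>
    rw [succ_nsmul, Finset.mem_add] at hy
    obtain ⟨z, hz, x, hx, rfl⟩ := hy
    obtain ⟨s, rfl, hs, rfl⟩ := ih hz
    refine ⟨x ::ₘ s, by simp, ?_, by simp [add_comm]⟩
    simpa [hx] using hs

theorem Finset.multiset_sum_mem_nsmul {M : Type*} [AddCommMonoid M] [DecidableEq M]
    {A : Finset M} {s : Multiset M} (hs : ∀ x ∈ s, x ∈ A) : s.sum ∈ s.card • A := by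
  induction s using Multiset.induction with
  | empty => simp
  | cons x s ih =>
    rw [Multiset.sum_cons, Multiset.card_cons, succ_nsmul, add_comm x]
    exact Finset.add_mem_add (ih fun y hy => hs y (Multiset.mem_cons_of_mem hy))
      (hs x (Multiset.mem_cons_self x s))

/-- If every element `x` of `A` has a positive multiple `(n + 1) • x` in `n • A + B`, where
`B ⊆ A`, then the sumsets of `A` eventually grow by adding `B` only. -/
theorem Finset.exists_nsmul_add_eq_succ_nsmul {M : Type*} [AddCommMonoid M] [DecidableEq M]
    {A B : Finset M} (hB : B ⊆ A)
    (h : ∀ x ∈ A, ∃ n : ℕ, (n + 1) • x ∈ n • A + B) : ∃ k : ℕ, k • A + B = (k + 1) • A := by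
  choose! n hn using h
  refine ⟨∑ x ∈ A, n x, (succ_nsmul A _ ▸ Finset.add_subset_add_left hB).antisymm fun y hy => ?_⟩
  obtain ⟨s, hcard, hs, rfl⟩ := Finset.exists_multiset_of_mem_nsmul hy
  obtain ⟨x, hx, hlt⟩ : ∃ x ∈ A, n x < s.count x := by
    apply Finset.exists_lt_of_sum_lt
    rw [Multiset.sum_count_eq_card hs]
    lia
  obtain ⟨t, rfl⟩ := Multiset.le_iff_exists_add.1 (Multiset.le_count_iff_replicate_le.1 hlt)
  have ht : t.sum ∈ t.card • A :=
    Finset.multiset_sum_mem_nsmul fun z hz => hs z (Multiset.mem_add.2 (Or.inr hz))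
  have hk : ∑ x ∈ A, n x = t.card + n x := by
    simp only [Multiset.card_add, Multiset.card_replicate] at hcard
    lia
  rw [hk, add_nsmul, add_assoc, Multiset.sum_add, Multiset.sum_replicate,
    add_comm _ t.sum]
  exact Finset.add_mem_add ht (hn x hx)

/-- Non-negative rationals `x ≤ a` are commensurable. -/
theorem NNRat.exists_succ_nsmul_eq_nsmul {x a : ℚ≥0} (h : x ≤ a) :
    ∃ n m : ℕ, m ≤ n + 1 ∧ (n + 1) • x = m • a := by
  rcases eq_or_ne a 0 with rfl | ha
  · exact ⟨0, 0, by simp, by simpa using h⟩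
  obtain ⟨n, hn⟩ := Nat.exists_eq_succ_of_ne_zero (x / a).den_ne_zero
  have hq : (x / a) * ((n + 1 : ℕ) : ℚ≥0) = (x / a).num := by
    rw [← Nat.succ_eq_add_one, ← hn, NNRat.mul_den_eq_num]
  refine ⟨n, (x / a).num, ?_, ?_⟩
  · have : ((x / a).num : ℚ≥0) ≤ ((n + 1 : ℕ) : ℚ≥0) := by
      rw [← hq]
      exact mul_le_of_le_one_left' (div_le_one_of_le₀ h zero_le)
    exact_mod_cast this
  · rw [nsmul_eq_mul, nsmul_eq_mul, ← hq]
    field_simp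

namespace RFPM

variable {S : AddSubmonoid ℚ≥0}

/-- The maximum of a finite subset, as a homomorphism to the underlying Puiseux monoid. -/
def maxHom (S : AddSubmonoid ℚ≥0) : RFPM S →+ S where
  toFun X := X.1.max' ⟨0, X.2⟩
  map_zero' := Finset.max'_singleton 0
  map_add' X Y := by
    apply le_antisymm
    · refine Finset.max'_le _ _ _ fun z hz => ?_
      obtain ⟨x, hx, y, hy, rfl⟩ := Finset.mem_add.1 hz
      exact add_le_add (Finset.le_max' _ _ hx) (Finset.le_max' _ _ hy)
    · exact Finset.le_max' _ _ (Finset.add_mem_add (Finset.max'_mem _ _) (Finset.max'_mem _ _))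

theorem maxHom_mem (X : RFPM S) : maxHom S X ∈ X.1 :=
  X.1.max'_mem ⟨0, X.2⟩

theorem le_maxHom (X : RFPM S) {x : S} (hx : x ∈ X.1) : x ≤ maxHom S X := Finset.le_max' _ _ hx

theorem maxHom_pair (a : S) : maxHom S (pair a) = a := by
  refine le_antisymm ?_ (le_maxHom _ (by simp [pair]))
  have := maxHom_mem (pair a)
  simp only [pair, Finset.mem_insert, Finset.mem_singleton] at this
  rcases this with h | h
  · exact h ▸ (zero_le : 0 ≤ (a : ℚ≥0))
  · exact h.le

/-- Large sumsets of `X` grow by adding `{0, max X}`. -/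
theorem exists_nsmul_add_pair (X : RFPM S) :
    ∃ k : ℕ, k • X + pair (maxHom S X) = (k + 1) • X := by
  have hX : (0 : S) ∈ X.1 := X.2
  have hmax := maxHom_mem X
  obtain ⟨k, hk⟩ := Finset.exists_nsmul_add_eq_succ_nsmul
    (A := X.1) (B := {0, maxHom S X}) (by simp [Finset.insert_subset_iff, hX, hmax]) <| by
      intro x hx
      obtain ⟨n, m, hm, h⟩ := NNRat.exists_succ_nsmul_eq_nsmul (le_maxHom X hx)
      have h' : (n + 1) • x = m • maxHom S X := Subtype.ext h
      refine ⟨n, h' ▸ ?_⟩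
      rcases hm.lt_or_eq with hlt | rfl
      · rw [← add_zero (m • maxHom S X)]
        exact Finset.add_mem_add
          (Finset.nsmul_subset_nsmul_right hX (Nat.lt_succ_iff.1 hlt)
            (Finset.nsmul_mem_nsmul hmax)) (by simp)
      · rw [succ_nsmul]
        exact Finset.add_mem_add (Finset.nsmul_mem_nsmul hmax) (by simp)
  exact ⟨k, Subtype.ext hk⟩

/-- A homomorphism of reduced finitary power monoids induces a map on maxima. -/
theorem maxHom_map {S T : AddSubmonoid ℚ≥0} (f : RFPM S →+ RFPM T) (X : RFPM S) :
    maxHom T (f (pair (maxHom S X))) = maxHom T (f X) := by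
  obtain ⟨k, hk⟩ := exists_nsmul_add_pair X
  have h := congrArg (fun Y => maxHom T (f Y)) hk
  simp only [map_add, map_nsmul, succ_nsmul] at h
  exact add_left_cancel h

/-- The isomorphism of Puiseux monoids induced by one of their reduced finitary power monoids. -/
def equivOfEquiv {S T : AddSubmonoid ℚ≥0} (f : RFPM S ≃+ RFPM T) : S ≃+ T where
  toFun a := maxHom T (f (pair a))
  invFun b := maxHom S (f.symm (pair b))
  left_inv a := by
    simpa [maxHom_pair] using maxHom_map f.symm.toAddMonoidHom (f (pair a))
  right_inv b := by
    simpa [maxHom_pair] using maxHom_map f.toAddMonoidHom (f.symm (pair b))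
  map_add' a b := by
    simpa [maxHom_pair] using maxHom_map f.toAddMonoidHom (pair a + pair b)

end RFPM

/-- A Puiseux monoid is a subset of the non-negative rationals containing `0` and closed under
addition, i.e., an additive submonoid of `ℚ≥0`. The reduced finitary power monoids of two
Puiseux monoids are isomorphic if and only if the monoids themselves are. -/
theorem rfpm_iso_iff_iso_of_puiseux (S₁ S₂ : AddSubmonoid ℚ≥0) :
    Nonempty (↥(RFPM ↥S₁) ≃+ ↥(RFPM ↥S₂)) ↔ Nonempty (↥S₁ ≃+ ↥S₂) :=
  ⟨fun ⟨f⟩ => ⟨RFPM.equivOfEquiv f⟩, fun ⟨e⟩ => ⟨RFPM.congr e⟩⟩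
end

section
/- Let $S_1$ and $S_2$ be numerical monoids. The reduced finitary power monoids $\mathcal P_{\mathrm{fin},0}(S_1)$ and $\mathcal P_{\mathrm{fin},0}(S_2)$ are isomorphic as monoids if and only if $S_1 = S_2$. -/
open scoped Pointwise

section NatSubmonoid

variable {S T : AddSubmonoid ℕ}

theorem Finset.sum_mem_card_nsmul {M ι : Type*} [AddCommMonoid M] [DecidableEq M]
    {X : Finset M} {f : ι → M} (s : Finset ι) (hf : ∀ i ∈ s, f i ∈ X) :
    ∑ i ∈ s, f i ∈ s.card • X := by
  classical
  induction s using Finset.induction_on with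
  | empty => simp
  | insert i s hi ih =>
    rw [Finset.sum_insert hi, Finset.card_insert_of_notMem hi, succ_nsmul']
    exact Finset.add_mem_add (hf i (by simp)) (ih fun j hj => hf j (by simp [hj]))

/-- Sufficiently large multiples of a finite set `X` containing `0` and with maximum `a` grow by
adding `{0, a}`. -/
theorem succ_nsmul_eq_nsmul_add_pair {X : Finset S} {a : S} (h0 : 0 ∈ X) (ha : a ∈ X)
    (hle : ∀ x ∈ X, x ≤ a) :
    (2 * (a : ℕ) + 1) • X = (2 * (a : ℕ)) • X + {0, a} := by
  apply Finset.Subset.antisymm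
  · intro x hx
    obtain ⟨f, rfl⟩ := Finset.mem_nsmul.1 hx
    rw [List.sum_ofFn]
    have hX : ∀ i, ((f i : S)) ∈ X := fun i => (f i).2
    by_cases hfa : ∃ i, (f i : S) = a
    · obtain ⟨i, hi⟩ := hfa
      rw [← Finset.sum_erase_add _ _ (Finset.mem_univ i), hi]
      refine Finset.add_mem_add ?_ (by simp)
      have := Finset.sum_mem_card_nsmul (Finset.univ.erase i) fun j _ => hX j
      rwa [Finset.card_erase_of_mem (Finset.mem_univ i), Finset.card_fin,
        Nat.add_sub_cancel] at this
    · push Not at hfa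
      have hlt : ∀ i, ((f i : S) : ℕ) < a := fun i => (hle _ (hX i)).lt_of_ne (hfa i)
      obtain ⟨t, -, htc, htd⟩ := Int.erdos_ginzburg_ziv (n := (a : ℕ)) (s := Finset.univ)
        (fun i => (((f i : S) : ℕ) : ℤ)) (by rw [Finset.card_fin]; omega)
      obtain ⟨j, hj⟩ : (a : ℕ) ∣ ∑ i ∈ t, ((f i : S) : ℕ) := by exact_mod_cast htd
      have hpos : 0 < (a : ℕ) := (Nat.zero_le _).trans_lt (hlt 0)
      have hja : j < a := by
        have : ∑ i ∈ t, ((f i : S) : ℕ) < ∑ _i ∈ t, (a : ℕ) :=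
          Finset.sum_lt_sum_of_nonempty (Finset.card_pos.1 (htc.symm ▸ hpos)) fun i _ => hlt i
        rw [hj, Finset.sum_const, htc, smul_eq_mul] at this
        exact Nat.lt_of_mul_lt_mul_left this
      have hsum : ∑ i ∈ t, (f i : S) = j • a := by
        apply Subtype.ext
        simp [hj, mul_comm]
      have hmem := Finset.add_mem_add (Finset.nsmul_mem_nsmul ha (n := j))
        (Finset.sum_mem_card_nsmul tᶜ fun i _ => hX i)
      rw [← hsum, Finset.sum_add_sum_compl, ← add_nsmul] at hmem
      have hk : j + tᶜ.card ≤ 2 * (a : ℕ) := by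
        rw [Finset.card_compl, htc, Fintype.card_fin]; omega
      rw [← add_zero (∑ i, (f i : S))]
      exact Finset.add_mem_add (Finset.nsmul_subset_nsmul_right h0 hk hmem) (by simp)
  · rw [succ_nsmul]
    refine Finset.add_subset_add_left ?_
    simp [Finset.insert_subset_iff, h0, ha]

/-- The maximum of a finite set containing `0`, as an additive homomorphism. -/
def RFPM.maxHom_s1 (S : AddSubmonoid ℕ) : RFPM S →+ S where
  toFun X := X.1.max' ⟨0, X.2⟩
  map_zero' := by
    apply le_antisymm
    · refine Finset.max'_le _ _ _ fun y hy => ?_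
      rw [Finset.mem_zero.1 hy]
    · exact Nat.zero_le _
  map_add' X Y := by
    apply le_antisymm
    · refine Finset.max'_le _ _ _ fun z hz => ?_
      obtain ⟨x, hx, y, hy, rfl⟩ := Finset.mem_add.1 hz
      exact add_le_add (Finset.le_max' _ _ hx) (Finset.le_max' _ _ hy)
    · exact Finset.le_max' _ _ (Finset.add_mem_add (Finset.max'_mem _ _) (Finset.max'_mem _ _))

/-- The pair `{0, a}` as an element of the reduced finitary power monoid. -/
def RFPM.pair_s1 (a : S) : RFPM S := ⟨{0, a}, Finset.mem_insert_self 0 {a}⟩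

theorem RFPM.maxHom_pair_s1 (a : S) : maxHom_s1 S (pair_s1 a) = a := by
  apply le_antisymm
  · refine Finset.max'_le _ ⟨0, (pair_s1 a).2⟩ _ fun y hy => ?_
    obtain rfl | rfl : y = 0 ∨ y = a := by simpa [pair_s1] using hy
    · exact Nat.zero_le _
    · exact le_rfl
  · exact Finset.le_max' _ _ (by simp [pair_s1])

theorem RFPM.succ_nsmul_eq (X : RFPM S) :
    (2 * (maxHom_s1 S X : ℕ) + 1) • X = (2 * (maxHom_s1 S X : ℕ)) • X + pair_s1 (maxHom_s1 S X) :=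
  Subtype.ext <| succ_nsmul_eq_nsmul_add_pair (a := maxHom_s1 S X) X.2
    (Finset.max'_mem X.1 ⟨0, X.2⟩) fun x hx => Finset.le_max' X.1 x hx

theorem RFPM.maxHom_map_pair (e : RFPM S →+ RFPM T) (X : RFPM S) :
    maxHom_s1 T (e (pair_s1 (maxHom_s1 S X))) = maxHom_s1 T (e X) := by
  have h := congrArg (fun Y => maxHom_s1 T (e Y)) (succ_nsmul_eq X)
  simp only [map_add, map_nsmul, succ_nsmul] at h
  exact (add_left_cancel h).symm

/-- A homomorphism of reduced finitary power monoids induces a homomorphism of the underlying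
monoids via maxima. -/
def RFPM.inducedHom (e : RFPM S →+ RFPM T) : S →+ T where
  toFun a := maxHom_s1 T (e (pair_s1 a))
  map_zero' := by
    rw [← map_zero (maxHom_s1 S), maxHom_map_pair, map_zero, map_zero]
  map_add' a b := by
    have h := maxHom_map_pair e (pair_s1 a + pair_s1 b)
    rwa [map_add (maxHom_s1 S), maxHom_pair_s1, maxHom_pair_s1, map_add e, map_add (maxHom_s1 T)] at h

theorem RFPM.inducedHom_maxHom (e : RFPM S →+ RFPM T) (X : RFPM S) :
    inducedHom e (maxHom_s1 S X) = maxHom_s1 T (e X) :=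
  maxHom_map_pair e X

theorem RFPM.inducedHom_symm_inducedHom (e : RFPM S ≃+ RFPM T) (a : S) :
    inducedHom (e.symm : RFPM T →+ RFPM S) (inducedHom (e : RFPM S →+ RFPM T) a) = a := by
  rw [← maxHom_pair_s1 a, inducedHom_maxHom, inducedHom_maxHom]
  simp

theorem dvd_map_of_finite_compl (hS : ((S : Set ℕ)ᶜ).Finite) (g : S →+ T) (a : S) :
    (a : ℕ) ∣ g a := by
  obtain ⟨N, hN⟩ := hS.bddAbove
  have hmem : ∀ n, N < n → n ∈ S := fun n hn => by
    by_contra h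
    exact absurd (hN h) (not_le.2 hn)
  have hlin : ∀ b : S, (a : ℕ) * g b = b * g a := fun b => by
    have h : (a : ℕ) • b = (b : ℕ) • a := Subtype.ext (by simp [mul_comm])
    simpa using congrArg (fun c => ((g c : T) : ℕ)) h
  have h₁ := hlin ⟨N + 1, hmem _ (by omega)⟩
  have h₂ := hlin ⟨N + 2, hmem _ (by omega)⟩
  refine (Nat.dvd_add_right (Dvd.intro _ h₁)).1 (Dvd.intro _ (h₂.trans ?_))
  ring

theorem le_of_rfpm_equiv (hS : ((S : Set ℕ)ᶜ).Finite) (hT : ((T : Set ℕ)ᶜ).Finite)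
    (e : RFPM S ≃+ RFPM T) : S ≤ T := by
  intro a ha
  have h₁ := dvd_map_of_finite_compl hS (RFPM.inducedHom (e : RFPM S →+ RFPM T)) ⟨a, ha⟩
  have h₂ := dvd_map_of_finite_compl hT (RFPM.inducedHom (e.symm : RFPM T →+ RFPM S))
    (RFPM.inducedHom (e : RFPM S →+ RFPM T) ⟨a, ha⟩)
  rw [RFPM.inducedHom_symm_inducedHom] at h₂
  rw [show a = _ from Nat.dvd_antisymm h₁ h₂]
  exact Subtype.property _

end NatSubmonoid

/-- The reduced finitary power monoids of two numerical monoids (submonoids of `(ℕ, +)` with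
finite complement) are isomorphic if and only if the numerical monoids are equal. -/
theorem rfpm_iso_iff_eq_of_numerical (S₁ S₂ : AddSubmonoid ℕ)
    (h₁ : ((S₁ : Set ℕ)ᶜ).Finite) (h₂ : ((S₂ : Set ℕ)ᶜ).Finite) :
    Nonempty (↥(RFPM ↥S₁) ≃+ ↥(RFPM ↥S₂)) ↔ S₁ = S₂ := by
  constructor
  · rintro ⟨e⟩
    exact le_antisymm (le_of_rfpm_equiv h₁ h₂ e) (le_of_rfpm_equiv h₂ h₁ e.symm)
  · rintro rfl
    exact ⟨AddEquiv.refl _⟩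
end

section
/- Let $S_1$ and $S_2$ be Puiseux monoids and $\phi \colon \mathcal P_{\mathrm{fin},0}(S_1) \to \mathcal P_{\mathrm{fin},0}(S_2)$ a monoid isomorphism. Then for every non-zero $a \in S_1$ there exists a non-zero $b \in S_2$ such that $\phi(\{0, a\}) = \{0, b\}$; in other words, $\phi$ sends every 2-element set to a 2-element set. -/
open scoped Pointwise NNRat

theorem mem_RFPM {M : Type*} [AddCommMonoid M] [DecidableEq M] {X : Finset M}
    (h : (0 : M) ∈ X) : X ∈ RFPM M := h

/-- Elements of the `n`-fold sumset of `X` are the sums of multisets of `n` elements of `X`. -/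
theorem Finset.mem_nsmul_iff_exists_multiset {M : Type*} [AddCommMonoid M] [DecidableEq M]
    {X : Finset M} {n : ℕ} {s : M} :
    s ∈ n • X ↔ ∃ t : Multiset M, t.card = n ∧ (∀ x ∈ t, x ∈ X) ∧ t.sum = s := by
  induction n generalizing s with
  | zero =>
    simp only [zero_smul, Finset.mem_zero, Multiset.card_eq_zero]
    constructor
    · rintro rfl
      exact ⟨0, by simp⟩
    · rintro ⟨t, rfl, -, rfl⟩
      rfl
  | succ n ih =>
    rw [succ_nsmul', Finset.mem_add]
    constructor
    · rintro ⟨x, hx, y, hy, rfl⟩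
      obtain ⟨t, rfl, htX, rfl⟩ := ih.1 hy
      refine ⟨x ::ₘ t, by simp, ?_, by simp⟩
      intro z hz
      rcases Multiset.mem_cons.1 hz with rfl | hz
      exacts [hx, htX z hz]
    · rintro ⟨t, ht, htX, rfl⟩
      obtain ⟨x, u, rfl⟩ : ∃ x u, t = x ::ₘ u := by
        obtain ⟨x, hx⟩ := Multiset.card_pos_iff_exists_mem.1 (ht.symm ▸ Nat.succ_pos n : 0 < t.card)
        exact ⟨x, Multiset.exists_cons_of_mem hx⟩
      refine ⟨x, htX x (by simp), u.sum, ih.2 ⟨u, by simpa using ht, ?_, rfl⟩, by simp⟩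
      exact fun z hz => htX z (Multiset.mem_cons_of_mem hz)

/-- If every element of `X` has a positive multiple that is a no larger multiple of `b`, then
passing from a large sumset of `X` to the next one amounts to adding `{0, b}`. -/
theorem Finset.exists_succ_nsmul_eq_nsmul_add_pair {M : Type*} [AddCommMonoid M] [DecidableEq M]
    {X : Finset M} {b : M} (h0 : 0 ∈ X) (hb : b ∈ X)
    (h : ∀ x ∈ X, ∃ n m : ℕ, 0 < n ∧ m ≤ n ∧ n • x = m • b) :
    ∃ k : ℕ, (k + 1) • X = k • X + {0, b} := by
  choose! n m hn hmn hnm using h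
  refine ⟨∑ x ∈ X, n x, Finset.Subset.antisymm ?_ ?_⟩
  · intro s hs
    obtain ⟨t, htc, htX, rfl⟩ := Finset.mem_nsmul_iff_exists_multiset.1 hs
    generalize hk : ∑ x ∈ X, n x = k at htc
    obtain ⟨x, hx, hxt⟩ : ∃ x ∈ X, n x ≤ t.count x := by
      by_contra! hlt
      have hle : ∑ x ∈ X, t.count x ≤ ∑ x ∈ X, n x :=
        Finset.sum_le_sum fun x hx => (hlt x hx).le
      rw [Multiset.sum_count_eq_card htX] at hle
      omega
    obtain ⟨u, rfl⟩ := Multiset.le_iff_exists_add.1 (Multiset.le_count_iff_replicate_le.1 hxt)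
    have hnx := hn x hx
    have hmx := hmn x hx
    have huX : ∀ z ∈ u, z ∈ X := fun z hz => htX z (Multiset.mem_add.2 (Or.inr hz))
    simp only [Multiset.card_add, Multiset.card_replicate] at htc
    simp only [Multiset.sum_add, Multiset.sum_replicate, hnm x hx]
    rcases hmx.lt_or_eq with hlt | heq
    · refine Finset.mem_add.2 ⟨m x • b + u.sum, ?_, 0, by simp, by simp⟩
      refine Finset.mem_nsmul_iff_exists_multiset.2 ⟨Multiset.replicate (m x) b +
        Multiset.replicate (n x - 1 - m x) 0 + u, ?_, ?_, by simp⟩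
      · simp only [Multiset.card_add, Multiset.card_replicate]
        omega
      · intro z hz
        rcases Multiset.mem_add.1 hz with hz | hz
        · rcases Multiset.mem_add.1 hz with hz | hz
          · rwa [Multiset.eq_of_mem_replicate hz]
          · rwa [Multiset.eq_of_mem_replicate hz]
        · exact huX z hz
    · refine Finset.mem_add.2 ⟨(m x - 1) • b + u.sum, ?_, b, by simp, ?_⟩
      · refine Finset.mem_nsmul_iff_exists_multiset.2
          ⟨Multiset.replicate (m x - 1) b + u, ?_, ?_, by simp⟩
        · simp only [Multiset.card_add, Multiset.card_replicate]
          omega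
        · intro z hz
          rcases Multiset.mem_add.1 hz with hz | hz
          · rwa [Multiset.eq_of_mem_replicate hz]
          · exact huX z hz
      · rw [add_right_comm, ← succ_nsmul, Nat.sub_add_cancel (by omega)]
  · rw [succ_nsmul]
    exact Finset.add_subset_add_left (by simp [Finset.insert_subset_iff, h0, hb])

/-- Two non-negative rationals `x ≤ b` are commensurable. -/
theorem NNRat.exists_nsmul_eq_nsmul_of_le {x b : ℚ≥0} (h : x ≤ b) :
    ∃ n m : ℕ, 0 < n ∧ m ≤ n ∧ n • x = m • b := by
  rcases eq_or_ne b 0 with rfl | hb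
  · exact ⟨1, 0, one_pos, zero_le_one, by simp [_root_.nonpos_iff_eq_zero.1 h]⟩
  · have hq : x / b ≤ 1 := div_le_one_of_le₀ h (by positivity)
    have hd : ((x / b).den : ℚ≥0) ≠ 0 := Nat.cast_ne_zero.2 (x / b).den_ne_zero
    have hnd : x / b = (x / b).num / (x / b).den := (NNRat.num_div_den _).symm
    refine ⟨(x / b).den, (x / b).num, (x / b).den_pos, ?_, ?_⟩
    · rw [hnd, div_le_one₀ (by positivity)] at hq
      exact_mod_cast hq
    · rw [div_eq_div_iff hb hd] at hnd
      rw [nsmul_eq_mul, nsmul_eq_mul, mul_comm, hnd]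

/-- If adding `Y` to `k • {0, a}` gives `(k + 1) • {0, a}`, then `Y ⊆ {0, a}`. -/
theorem Finset.subset_pair_of_succ_nsmul_eq {S : AddSubmonoid ℚ≥0} {a : S} {Y : Finset S} {k : ℕ}
    (h : (k + 1) • ({0, a} : Finset S) = k • {0, a} + Y) : Y ⊆ {0, a} := by
  intro y hy
  have hka : k • a ∈ k • ({0, a} : Finset S) := Finset.nsmul_mem_nsmul (by simp)
  have hmem := Finset.add_mem_add hka hy
  rw [← h, Finset.mem_nsmul_iff_exists_multiset] at hmem
  obtain ⟨t, htc, htX, hts⟩ := hmem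
  have hsum : ∀ t : Multiset S, (∀ x ∈ t, x ∈ ({0, a} : Finset S)) →
      ∃ j ≤ t.card, t.sum = j • a := by
    intro t
    induction t using Multiset.induction_on with
    | empty => exact fun _ => ⟨0, by simp⟩
    | cons x t ih =>
      intro ht
      obtain ⟨j, hj, hjs⟩ := ih fun z hz => ht z (Multiset.mem_cons_of_mem hz)
      have hx := ht x (Multiset.mem_cons_self x t)
      simp only [Finset.mem_insert, Finset.mem_singleton] at hx
      rcases hx with rfl | rfl
      · exact ⟨j, by simp; omega, by simp [hjs]⟩
      · exact ⟨j + 1, by simpa using hj, by simp [hjs, succ_nsmul']⟩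
  obtain ⟨j, hj, hjs⟩ := hsum t htX
  rw [hjs] at hts
  simp only [Finset.mem_insert, Finset.mem_singleton]
  rcases (htc ▸ hj).lt_or_eq with hlt | rfl
  · left
    obtain ⟨d, rfl⟩ := Nat.exists_eq_add_of_le (Nat.lt_succ_iff.1 hlt)
    rw [add_nsmul, add_assoc, left_eq_add] at hts
    have hts' : ((d • a : S) : ℚ≥0) + y = 0 := congrArg Subtype.val hts
    exact Subtype.ext (add_eq_zero.1 hts').2
  · right
    rw [succ_nsmul] at hts
    exact (add_left_cancel hts).symm

/-- An isomorphism between the reduced finitary power monoids of two Puiseux monoids sends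
every `2`-element set to a `2`-element set: for every non-zero `a ∈ S₁` there is a non-zero
`b ∈ S₂` with `φ {0, a} = {0, b}`. -/
theorem iso_maps_pairs_to_pairs (S₁ S₂ : AddSubmonoid ℚ≥0)
    (φ : ↥(RFPM ↥S₁) ≃+ ↥(RFPM ↥S₂)) (a : ↥S₁) (ha : a ≠ 0) :
    ∃ b : ↥S₂, b ≠ 0 ∧
      ((φ ⟨({0, a} : Finset ↥S₁), mem_RFPM (Finset.mem_insert_self 0 {a})⟩ :
        ↥(RFPM ↥S₂)) : Finset ↥S₂) = {0, b} := by
  set A : RFPM S₁ := ⟨{0, a}, mem_RFPM (Finset.mem_insert_self 0 {a})⟩ with hA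
  have hB0 : (0 : S₂) ∈ (φ A : Finset S₂) := (φ A).2
  obtain ⟨b, hbB, hmax⟩ := (φ A : Finset S₂).exists_max_image id ⟨0, hB0⟩
  have hb : b ≠ 0 := by
    rintro rfl
    have hφ : φ A = 0 := by
      refine Subtype.ext (Finset.Subset.antisymm (fun x hx => ?_) (by simpa using hB0))
      exact Finset.mem_zero.2 (Subtype.ext (nonpos_iff_eq_zero.1 (hmax x hx)))
    have hval : ({0, a} : Finset S₁) = 0 :=
      congrArg Subtype.val ((EmbeddingLike.map_eq_zero_iff (f := φ)).1 hφ)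
    have : a ∈ (0 : Finset S₁) := hval ▸ by simp
    exact ha (Finset.mem_zero.1 this)
  refine ⟨b, hb, ?_⟩
  obtain ⟨k, hk⟩ := Finset.exists_succ_nsmul_eq_nsmul_add_pair hB0 hbB fun x hx => by
    obtain ⟨n, m, hn, hmn, h⟩ := NNRat.exists_nsmul_eq_nsmul_of_le (hmax x hx)
    exact ⟨n, m, hn, hmn, Subtype.ext (by simpa using h)⟩
  set P : RFPM S₂ := ⟨{0, b}, mem_RFPM (Finset.mem_insert_self 0 {b})⟩ with hP
  have hkφ : (k + 1) • φ A = k • φ A + P := Subtype.ext (by simpa [hP] using hk)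
  have hkA : (k + 1) • A = k • A + φ.symm P := φ.injective (by simpa using hkφ)
  have hsub : (φ.symm P : Finset S₁) ⊆ {0, a} :=
    Finset.subset_pair_of_succ_nsmul_eq (k := k) (by simpa [hA] using congrArg Subtype.val hkA)
  have h0Y : (0 : S₁) ∈ (φ.symm P : Finset S₁) := (φ.symm P).2
  have haY : a ∈ (φ.symm P : Finset S₁) := by
    by_contra haY
    have hY : φ.symm P = 0 := by
      refine Subtype.ext (Finset.Subset.antisymm (fun x hx => ?_) (by simpa using h0Y))
      rcases Finset.mem_insert.1 (hsub hx) with rfl | hxa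
      · exact Finset.zero_mem_zero
      · exact absurd (Finset.mem_singleton.1 hxa ▸ hx) haY
    have hval : ({0, b} : Finset S₂) = 0 :=
      congrArg Subtype.val ((EmbeddingLike.map_eq_zero_iff (f := φ.symm)).1 hY)
    have : b ∈ (0 : Finset S₂) := hval ▸ by simp
    exact hb (Finset.mem_zero.1 this)
  have hAY : A = φ.symm P :=
    Subtype.ext (Finset.Subset.antisymm (by simp [hA, Finset.insert_subset_iff, h0Y, haY]) hsub)
  rw [hAY, AddEquiv.apply_symm_apply]
end

section
/- (Nathanson's theorem.) Let $A$ be a finite subset of $\mathbb N$ with $0 \in A$ and $\gcd A = 1$, and set $a := \max A$ and $n := |A| - 1$. Then there exist $b, c \in \mathbb N$, a set $B \subseteq \llbracket 0, b-2 \rrbracket$, and a set $C \subseteq \llbracket 0, c-2 \rrbracket$ such that for every integer $k \ge a^2 n$ one has $kA = B \cup \llbracket b, ka - c \rrbracket \cup (ka - C)$. -/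
open scoped Pointwise

theorem List.sum_mem_nsmul_finset {A : Finset ℤ} (h0 : (0 : ℤ) ∈ A) (l : List ℤ)
    (hl : ∀ x ∈ l, x ∈ A) (k : ℕ) (hk : l.length ≤ k) : l.sum ∈ k • A := by
  induction l generalizing k with
  | nil =>
    simpa using Finset.nsmul_mem_nsmul (n := k) h0
  | cons y l ih =>
    obtain _ | k := k
    · simp at hk
    · rw [List.sum_cons, succ_nsmul', Finset.mem_add]
      exact ⟨y, hl y (by simp), l.sum, ih (fun x hx => hl x (by simp [hx])) k (by simpa using hk),
        rfl⟩

theorem mem_closure_of_mem_nsmul {A : Finset ℤ} {k : ℕ} {x : ℤ} (hx : x ∈ k • A) :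
    x ∈ AddSubmonoid.closure (A : Set ℤ) := by
  induction k generalizing x with
  | zero => simp_all
  | succ k ih =>
    rw [succ_nsmul, Finset.mem_add] at hx
    obtain ⟨y, hy, z, hz, rfl⟩ := hx
    exact add_mem (ih hy) (AddSubmonoid.subset_closure hz)

/-- A list of at least `a` integers contains a non-empty block of consecutive terms whose sum is
divisible by `a`. -/
theorem List.exists_append_sum_dvd {a : ℕ} (ha : 0 < a) (l : List ℤ) (hl : a ≤ l.length) :
    ∃ u v w : List ℤ, l = u ++ v ++ w ∧ v ≠ [] ∧ (a : ℤ) ∣ v.sum := by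
  obtain ⟨i, hi, j, hj, hij, h⟩ :=
    Finset.exists_ne_map_eq_of_card_lt_of_maps_to
      (s := Finset.range (a + 1)) (t := Finset.Ico (0 : ℤ) a)
      (f := fun i => (l.take i).sum % a) (by simp)
      (fun i _ => by
        simp only [Finset.coe_Ico, Set.mem_Ico]
        exact ⟨Int.emod_nonneg _ (by omega), Int.emod_lt_of_pos _ (by omega)⟩)
  wlog hlt : i < j generalizing i j
  · exact this j hj i hi hij.symm h.symm (by omega)
  simp only [Finset.mem_range] at hi hj
  have htake : l.take j = l.take i ++ (l.drop i).take (j - i) := by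
    rw [← List.take_add]
    congr 1
    omega
  refine ⟨l.take i, (l.drop i).take (j - i), l.drop j, ?_, ?_, ?_⟩
  · rw [← htake, List.take_append_drop]
  · intro hnil
    have := congrArg List.length hnil
    simp at this
    omega
  · have hdvd := Int.ModEq.dvd h
    rwa [htake, List.sum_append, add_sub_cancel_left] at hdvd

/-- Every element of the monoid generated by `A` is a sum of fewer than `a` elements of `A`
and a multiple of `a`. -/
theorem exists_short_sum_add_mul {A : Finset ℤ} (hA : ∀ x ∈ A, 0 ≤ x) {a : ℕ} (ha : 0 < a)
    {x : ℤ} (hx : x ∈ AddSubmonoid.closure (A : Set ℤ)) :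
    ∃ (l : List ℤ) (m : ℕ), (∀ y ∈ l, y ∈ A) ∧ l.length < a ∧ x = l.sum + m * a := by
  obtain ⟨l, hl, rfl⟩ := AddSubmonoid.exists_list_of_mem_closure hx
  clear hx
  induction hn : l.length using Nat.strong_induction_on generalizing l with
  | _ n ih =>
    by_cases hla : l.length < a
    · exact ⟨l, 0, hl, hla, by simp⟩
    obtain ⟨u, v, w, rfl, hv, q, hq⟩ := l.exists_append_sum_dvd ha (by omega)
    have hpos := List.length_pos_of_ne_nil hv
    obtain ⟨l', m, hl', hlen, hsum⟩ := ih (u ++ w).length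
      (by simp only [List.length_append] at hn ⊢; omega) (u ++ w)
      (fun y hy => hl y (by simp only [List.mem_append] at hy ⊢; tauto)) rfl
    have hv0 : 0 ≤ v.sum := List.sum_nonneg fun y hy => hA y (hl y (by simp [hy]))
    have hq0 : 0 ≤ q := by
      rw [hq] at hv0
      exact nonneg_of_mul_nonneg_right hv0 (by omega)
    lift q to ℕ using hq0
    refine ⟨l', m + q, hl', hlen, ?_⟩
    simp only [List.sum_append] at hsum ⊢
    push_cast
    linarith

theorem mem_nsmul_of_mem_closure {A : Finset ℤ} (h0 : (0 : ℤ) ∈ A) (hA : ∀ x ∈ A, 0 ≤ x)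
    {a : ℕ} (ha : 0 < a) (haA : (a : ℤ) ∈ A) {x : ℤ}
    (hx : x ∈ AddSubmonoid.closure (A : Set ℤ)) {k : ℕ} (hk : 2 * a ≤ k + 2)
    (hxk : 2 * x ≤ k * a) : x ∈ k • A := by
  obtain ⟨l, m, hl, hlen, rfl⟩ := exists_short_sum_add_mul hA ha hx
  have hl0 : 0 ≤ l.sum := List.sum_nonneg fun y hy => hA y (hl y hy)
  have hm : (2 * m : ℤ) ≤ k := by
    have : (2 * m * a : ℤ) ≤ k * a := by linarith
    exact le_of_mul_le_mul_right this (by exact_mod_cast ha)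
  have := List.sum_mem_nsmul_finset h0 (l ++ List.replicate m (a : ℤ))
    (by
      intro y hy
      rcases List.mem_append.1 hy with hy | hy
      · exact hl y hy
      · rw [List.eq_of_mem_replicate hy]
        exact haA) k
    (by
      simp only [List.length_append, List.length_replicate]
      omega)
  simpa using this

theorem exists_mem_closure_dvd_sub {A : Finset ℤ}
    (hgcd : ∀ d : ℤ, (∀ x ∈ A, d ∣ x) → IsUnit d) {a : ℕ} (ha : 0 < a) (z : ℤ) :
    ∃ y ∈ AddSubmonoid.closure (A : Set ℤ), (a : ℤ) ∣ z - y := by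
  let H : AddSubgroup ℤ :=
    { carrier := {z | ∃ y ∈ AddSubmonoid.closure (A : Set ℤ), (a : ℤ) ∣ z - y}
      zero_mem' := ⟨0, zero_mem _, by simp⟩
      add_mem' := by
        rintro z w ⟨y, hy, hzy⟩ ⟨t, ht, hwt⟩
        refine ⟨y + t, add_mem hy ht, ?_⟩
        rw [add_sub_add_comm]
        exact dvd_add hzy hwt
      neg_mem' := by
        rintro z ⟨y, hy, q, hq⟩
        refine ⟨(a - 1) • y, nsmul_mem hy _, -q - y, ?_⟩
        rw [nsmul_eq_mul]
        push_cast [Nat.cast_sub (show 1 ≤ a from ha)]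
        linear_combination -hq }
  obtain ⟨g, hg⟩ := Int.subgroup_cyclic H
  have hunit : IsUnit g := hgcd g fun x hx => by
    have hxH : x ∈ H := ⟨x, AddSubmonoid.subset_closure hx, by simp⟩
    rwa [hg, ← AddSubgroup.zmultiples_eq_closure, Int.mem_zmultiples_iff] at hxH
  change z ∈ H
  rw [hg, ← AddSubgroup.zmultiples_eq_closure, Int.mem_zmultiples_iff]
  exact hunit.dvd

theorem mem_closure_of_le {A : Finset ℤ} (hA : ∀ x ∈ A, 0 ≤ x) {a : ℕ} (ha : 0 < a)
    (haA : (a : ℤ) ∈ A) (hle : ∀ x ∈ A, x ≤ a)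
    (hgcd : ∀ d : ℤ, (∀ x ∈ A, d ∣ x) → IsUnit d) {x : ℤ} (hx : (a * (a - 1) : ℤ) ≤ x) :
    x ∈ AddSubmonoid.closure (A : Set ℤ) := by
  obtain ⟨y, hy, hxy⟩ := exists_mem_closure_dvd_sub hgcd ha x
  obtain ⟨l, m, hl, hlen, rfl⟩ := exists_short_sum_add_mul hA ha hy
  have hsum : l.sum ≤ l.length • (a : ℤ) := List.sum_le_card_nsmul _ _ fun y hy => hle y (hl y hy)
  have hlx : l.sum ≤ x := by
    rw [nsmul_eq_mul] at hsum
    have : (l.length : ℤ) ≤ a - 1 := by omega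
    nlinarith
  obtain ⟨q, hq⟩ : (a : ℤ) ∣ x - l.sum := by
    obtain ⟨r, hr⟩ := hxy
    exact ⟨r + m, by linear_combination hr⟩
  have hq0 : 0 ≤ q := nonneg_of_mul_nonneg_right (hq ▸ sub_nonneg.2 hlx) (by omega)
  lift q to ℕ using hq0
  have hx' : x = l.sum + q • (a : ℤ) := by
    rw [nsmul_eq_mul]
    linarith
  rw [hx']
  exact add_mem (list_sum_mem fun y hy => AddSubmonoid.subset_closure (hl y hy))
    (nsmul_mem (AddSubmonoid.subset_closure haA) _)

theorem nonneg_of_mem_closure {A : Finset ℤ} (hA : ∀ x ∈ A, 0 ≤ x) {x : ℤ}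
    (hx : x ∈ AddSubmonoid.closure (A : Set ℤ)) : 0 ≤ x :=
  (AddSubmonoid.closure_le (S := AddSubmonoid.nonneg ℤ)).2 (fun x hx => hA x hx) hx

/-- The conductor of the numerical semigroup generated by `A`, with the classical bound. -/
theorem exists_conductor {A : Finset ℤ} (hA : ∀ x ∈ A, 0 ≤ x) {a : ℕ} (ha : 0 < a)
    (haA : (a : ℤ) ∈ A) (hle : ∀ x ∈ A, x ≤ a)
    (hgcd : ∀ d : ℤ, (∀ x ∈ A, d ∣ x) → IsUnit d) :
    ∃ b : ℤ, 0 ≤ b ∧ b ≤ a * (a - 1) ∧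
      (∀ x, b ≤ x → x ∈ AddSubmonoid.closure (A : Set ℤ)) ∧
      b - 1 ∉ AddSubmonoid.closure (A : Set ℤ) := by
  classical
  have hex : ∃ b : ℕ, ∀ x : ℤ, (b : ℤ) ≤ x → x ∈ AddSubmonoid.closure (A : Set ℤ) :=
    ⟨a * (a - 1), fun x hx => mem_closure_of_le hA ha haA hle hgcd (by
      push_cast [Nat.cast_sub (show 1 ≤ a from ha)] at hx
      exact hx)⟩
  refine ⟨Nat.find hex, by positivity, ?_, Nat.find_spec hex, fun hmem => ?_⟩
  · have := Nat.find_min' hex (m := a * (a - 1)) fun x hx =>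
      mem_closure_of_le hA ha haA hle hgcd (by
        push_cast [Nat.cast_sub (show 1 ≤ a from ha)] at hx
        exact hx)
    zify [show 1 ≤ a from ha] at this
    exact this
  · have h1 := nonneg_of_mem_closure hA hmem
    refine Nat.find_min hex (m := Nat.find hex - 1) (by omega) fun x hx => ?_
    rcases eq_or_ne x (Nat.find hex - 1 : ℤ) with rfl | hne
    · exact hmem
    · exact Nat.find_spec hex x (by omega)

theorem mem_nsmul_image_sub {A : Finset ℤ} {a : ℤ} {k : ℕ} {x : ℤ} :
    x ∈ k • A.image (fun y => a - y) ↔ k * a - x ∈ k • A := by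
  induction k generalizing x with
  | zero => simp
  | succ k ih =>
    simp only [succ_nsmul, Finset.mem_add, ih, Finset.mem_image]
    constructor
    · rintro ⟨y, hy, _, ⟨z, hz, rfl⟩, rfl⟩
      exact ⟨_, hy, z, hz, by push_cast; ring⟩
    · rintro ⟨y, hy, z, hz, h⟩
      refine ⟨k * a - y, by simpa using hy, a - z, ⟨z, hz, rfl⟩, ?_⟩
      push_cast at h
      linarith

/-- For large `k`, an integer is in `kA` as soon as the two obvious necessary conditions hold. -/
theorem mem_nsmul_iff_mem_closure {A : Finset ℤ} (h0 : (0 : ℤ) ∈ A) (hA : ∀ x ∈ A, 0 ≤ x)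
    {a : ℕ} (ha : 0 < a) (haA : (a : ℤ) ∈ A) (hle : ∀ x ∈ A, x ≤ a) {k : ℕ}
    (hk : 2 * a ≤ k + 2) {x : ℤ} :
    x ∈ k • A ↔ x ∈ AddSubmonoid.closure (A : Set ℤ) ∧
      k * a - x ∈ AddSubmonoid.closure ((A.image fun y => (a : ℤ) - y : Finset ℤ) : Set ℤ) := by
  refine ⟨fun hx => ⟨mem_closure_of_mem_nsmul hx, mem_closure_of_mem_nsmul (k := k) ?_⟩, ?_⟩
  · rw [mem_nsmul_image_sub]
    simpa using hx
  · rintro ⟨hx, hx'⟩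
    rcases le_total (2 * x) (k * a) with h | h
    · exact mem_nsmul_of_mem_closure h0 hA ha haA hx hk h
    · have := mem_nsmul_of_mem_closure (A := A.image fun y => (a : ℤ) - y)
        (Finset.mem_image.2 ⟨a, haA, by simp⟩)
        (Finset.forall_mem_image.2 fun y hy => sub_nonneg.2 (hle y hy)) ha (Finset.mem_image.2 ⟨0, h0, by simp⟩) hx' hk
        (by linarith)
      rw [mem_nsmul_image_sub] at this
      simpa using this

/-- **Nathanson's theorem** (Fundamental Theorem of Additive Combinatorics).
Let `A` be a finite set of non-negative integers (viewed inside `ℤ`, so that discrete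
intervals behave as in `ℤ`) with `0 ∈ A` and `gcd A = 1`, and set `a := max A` and
`n := |A| - 1`. Then there are `b, c ∈ ℕ`, `B ⊆ ⟦0, b-2⟧` and `C ⊆ ⟦0, c-2⟧` such that
`kA = B ∪ ⟦b, ka - c⟧ ∪ (ka - C)` for every integer `k ≥ a² n`. -/
theorem nathanson (A : Finset ℤ) (h0 : (0 : ℤ) ∈ A) (hA : ∀ x ∈ A, 0 ≤ x)
    (hgcd : A.gcd id = 1) :
    ∃ b c : ℤ, 0 ≤ b ∧ 0 ≤ c ∧
      ∃ B C : Finset ℤ, B ⊆ Finset.Icc 0 (b - 2) ∧ C ⊆ Finset.Icc 0 (c - 2) ∧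
        ∀ k : ℕ, ((A.max' ⟨0, h0⟩) ^ 2 * (A.card - 1 : ℕ) : ℤ) ≤ (k : ℤ) →
          k • A =
            (B ∪ Finset.Icc b ((k : ℤ) * A.max' ⟨0, h0⟩ - c)) ∪
              C.image (fun x => (k : ℤ) * A.max' ⟨0, h0⟩ - x) := by
  classical
  have haA := A.max'_mem ⟨0, h0⟩
  have hle : ∀ x ∈ A, x ≤ A.max' ⟨0, h0⟩ := fun x hx => A.le_max' x hx
  generalize A.max' ⟨0, h0⟩ = a at haA hle ⊢
  lift a to ℕ using hA a haA
  have hdvd : ∀ d : ℤ, (∀ x ∈ A, d ∣ x) → IsUnit d := fun d hd =>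
    isUnit_of_dvd_one (hgcd ▸ Finset.dvd_gcd hd)
  have ha : 0 < a := by
    rw [Nat.pos_iff_ne_zero]
    rintro rfl
    exact not_isUnit_zero (hdvd 0 fun x hx => by
      rw [le_antisymm (hle x hx) (hA x hx), Nat.cast_zero])
  have hcard : 1 ≤ A.card - 1 := by
    have : 1 < A.card := Finset.one_lt_card.2 ⟨0, h0, a, haA, by omega⟩
    omega
  set A' : Finset ℤ := A.image fun y => (a : ℤ) - y with hA'
  have haA' : (a : ℤ) ∈ A' := Finset.mem_image.2 ⟨0, h0, by simp⟩
  have hnonneg' : ∀ x ∈ A', 0 ≤ x := Finset.forall_mem_image.2 fun y hy => sub_nonneg.2 (hle y hy)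
  have hle' : ∀ x ∈ A', x ≤ a := Finset.forall_mem_image.2 fun y hy => sub_le_self _ (hA y hy)
  have hdvd' : ∀ d : ℤ, (∀ x ∈ A', d ∣ x) → IsUnit d := fun d hd => hdvd d fun x hx =>
    (dvd_sub_right (hd a haA')).1 (hd _ (Finset.mem_image_of_mem _ hx))
  obtain ⟨b, hb0, hba, hb, hb1⟩ := exists_conductor hA ha haA hle hdvd
  obtain ⟨c, hc0, hca, hc, hc1⟩ := exists_conductor hnonneg' ha haA' hle' hdvd'
  refine ⟨b, c, hb0, hc0,
    {x ∈ Finset.Icc 0 (b - 2) | x ∈ AddSubmonoid.closure (A : Set ℤ)},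
    {x ∈ Finset.Icc 0 (c - 2) | x ∈ AddSubmonoid.closure (A' : Set ℤ)},
    Finset.filter_subset _ _, Finset.filter_subset _ _, fun k hk => ?_⟩
  have hka : (a : ℤ) ^ 2 ≤ k := by
    have : (1 : ℤ) ≤ (A.card - 1 : ℕ) := by exact_mod_cast hcard
    nlinarith [sq_nonneg (a : ℤ)]
  have hk2 : (2 * a : ℤ) ≤ k + 2 := by nlinarith [sq_nonneg ((a : ℤ) - 1)]
  have hbc : b + c ≤ k * a := by
    have : (2 * a - 2 : ℤ) * a ≤ k * a := by gcongr; linarith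
    linarith
  ext x
  rw [mem_nsmul_iff_mem_closure h0 hA ha haA hle (by exact_mod_cast hk2), ← hA']
  simp only [Finset.mem_union, Finset.mem_filter, Finset.mem_Icc, Finset.mem_image]
  constructor
  · rintro ⟨hx, hx'⟩
    have hx0 := nonneg_of_mem_closure hA hx
    have hx0' := nonneg_of_mem_closure hnonneg' hx'
    have hxb : x ≠ b - 1 := fun h => hb1 (h ▸ hx)
    have hxc : k * a - x ≠ c - 1 := fun h => hc1 (h ▸ hx')
    by_cases h1 : x < b
    · exact .inl (.inl ⟨⟨hx0, by omega⟩, hx⟩)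
    by_cases h2 : k * a - x < c
    · exact .inr ⟨k * a - x, ⟨⟨hx0', by omega⟩, hx'⟩, by ring⟩
    · exact .inl (.inr ⟨by omega, by omega⟩)
  · rintro ((⟨⟨h1, h2⟩, hx⟩ | ⟨h1, h2⟩) | ⟨y, ⟨⟨h1, h2⟩, hy⟩, rfl⟩)
    · exact ⟨hx, hc _ (by linarith)⟩
    · exact ⟨hb _ h1, hc _ (by linarith)⟩
    · exact ⟨hb _ (by linarith), by simpa using hy⟩
end

section
/- Let $M$ be a breakable monoid, i.e., a monoid such that $xy \in \{x, y\}$ for all $x, y \in M$. Then the reduced finitary power monoids of $M$ and of its opposite monoid $M^{\mathrm{op}}$ coincide: for all finite subsets $X, Y$ of $M$ containing $1_M$, the setwise product of $X$ and $Y$ computed in $M$ equals the setwise product computed in $M^{\mathrm{op}}$; hence the identity map is a monoid isomorphism from $\mathcal P_{\mathrm{fin},1}(M)$ to $\mathcal P_{\mathrm{fin},1}(M^{\mathrm{op}})$. -/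
open scoped Pointwise

/-- The reduced finitary power monoid of a monoid `M`: the finite subsets of `M` containing
`1`, under setwise multiplication, viewed as a submonoid of `Finset M`. -/
def RFPM1 (M : Type*) [Monoid M] [DecidableEq M] : Submonoid (Finset M) where
  carrier := {X | (1 : M) ∈ X}
  one_mem' := Finset.one_mem_one
  mul_mem' := fun h1 h2 => by simpa using Finset.mul_mem_mul h1 h2

/-- In a breakable monoid, the product of two finite sets containing `1` is their union. -/
theorem Finset.mul_eq_union_of_breakable {M : Type*} [Monoid M] [DecidableEq M]
    (hM : ∀ x y : M, x * y = x ∨ x * y = y) {X Y : Finset M}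
    (hX : (1 : M) ∈ X) (hY : (1 : M) ∈ Y) : X * Y = X ∪ Y := by
  ext z
  rw [Finset.mem_mul, Finset.mem_union]
  constructor
  · rintro ⟨x, hx, y, hy, rfl⟩
    rcases hM x y with h | h <;> rw [h]
    exacts [Or.inl hx, Or.inr hy]
  · rintro (hz | hz)
    exacts [⟨z, hz, 1, hY, mul_one z⟩, ⟨1, hX, z, hz, one_mul z⟩]

/-- The opposite of a breakable monoid is breakable. -/
theorem MulOpposite.breakable {M : Type*} [Monoid M]
    (hM : ∀ x y : M, x * y = x ∨ x * y = y) (x y : Mᵐᵒᵖ) : x * y = x ∨ x * y = y :=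
  (hM y.unop x.unop).symm.imp (fun h => MulOpposite.unop_injective h)
    (fun h => MulOpposite.unop_injective h)

/-- For a breakable monoid `M` (one where `x * y ∈ {x, y}` for all `x, y`), the setwise
product of two finite subsets containing `1`, computed in `M`, equals the setwise product
computed in the opposite monoid `Mᵐᵒᵖ` (transported along the canonical identification
`op : M → Mᵐᵒᵖ` of the underlying sets); hence the identity map (i.e., `X ↦ op(X)`) is a
monoid isomorphism from `𝒫_fin,1(M)` to `𝒫_fin,1(Mᵐᵒᵖ)`. -/
theorem rfpm_op_eq_of_breakable (M : Type*) [Monoid M] [DecidableEq M]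
    (hM : ∀ x y : M, x * y = x ∨ x * y = y) :
    (∀ X Y : Finset M, (1 : M) ∈ X → (1 : M) ∈ Y →
      (X.image MulOpposite.op * Y.image MulOpposite.op).image MulOpposite.unop = X * Y) ∧
    ∃ F : ↥(RFPM1 M) ≃* ↥(RFPM1 Mᵐᵒᵖ), ∀ X : ↥(RFPM1 M),
      ((F X : ↥(RFPM1 Mᵐᵒᵖ)) : Finset Mᵐᵒᵖ) = (X : Finset M).image MulOpposite.op := by
  have op_mem {X : Finset M} (hX : (1 : M) ∈ X) : (1 : Mᵐᵒᵖ) ∈ X.image MulOpposite.op :=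
    Finset.mem_image_of_mem MulOpposite.op hX
  have unop_mem {X : Finset Mᵐᵒᵖ} (hX : (1 : Mᵐᵒᵖ) ∈ X) : (1 : M) ∈ X.image MulOpposite.unop :=
    Finset.mem_image_of_mem MulOpposite.unop hX
  have op_mul {X Y : Finset M} (hX : (1 : M) ∈ X) (hY : (1 : M) ∈ Y) :
      (X * Y).image MulOpposite.op = X.image MulOpposite.op * Y.image MulOpposite.op := by
    rw [Finset.mul_eq_union_of_breakable hM hX hY, Finset.image_union,
      Finset.mul_eq_union_of_breakable (MulOpposite.breakable hM) (op_mem hX) (op_mem hY)]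
  have unop_op (X : Finset M) : (X.image MulOpposite.op).image MulOpposite.unop = X := by
    simp [Finset.image_image]
  have op_unop (X : Finset Mᵐᵒᵖ) : (X.image MulOpposite.unop).image MulOpposite.op = X := by
    simp [Finset.image_image]
  refine ⟨fun X Y hX hY => by rw [← op_mul hX hY, unop_op], ?_⟩
  exact ⟨{ toFun := fun X => ⟨(X : Finset M).image MulOpposite.op, op_mem X.2⟩
           invFun := fun X => ⟨(X : Finset Mᵐᵒᵖ).image MulOpposite.unop, unop_mem X.2⟩
           left_inv := fun X => Subtype.ext (unop_op X)
           right_inv := fun X => Subtype.ext (op_unop X)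
           map_mul' := fun X Y => Subtype.ext (op_mul X.2 Y.2) }, fun _ => rfl⟩
end

section
/- For every cardinal number $\kappa \ge 2$ (finite or infinite), there exist monoids $H$ and $K$ whose underlying sets both have cardinality $\kappa$, such that $H$ and $K$ are not isomorphic as monoids, but $\mathcal P_{\mathrm{fin},1}(H)$ and $\mathcal P_{\mathrm{fin},1}(K)$ are isomorphic as monoids. -/
open scoped Pointwise

universe u

/-- The left zero band on `α \ {a}` with the identity `a` adjoined. -/
@[reducible]
def leftZeroMonoid {α : Type*} [DecidableEq α] (a : α) : Monoid α where
  one := a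
  mul x y := if x = a then y else x
  one_mul x := if_pos rfl
  mul_one x := by
    change (if x = a then a else x) = x
    grind
  mul_assoc x y z := by
    change (if (if x = a then y else x) = a then z else if x = a then y else x) =
      if x = a then (if y = a then z else y) else x
    grind

/-- The left zero band on `α \ {a, b}` with the two-element group `{a, b}`, whose identity
is `a`, adjoined as a group of units acting trivially. -/
@[reducible]
def unitsLeftZeroMonoid {α : Type*} [DecidableEq α] (a b : α) : Monoid α where
  one := a
  mul x y := if x = a then y else if x = b then (if y = a then b else if y = b then a else y) else x
  one_mul x := if_pos rfl
  mul_one x := by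
    change (if x = a then a else if x = b then (if a = a then b else if a = b then a else a)
      else x) = x
    grind
  mul_assoc x y z := by
    let m (x y : α) : α :=
      if x = a then y else if x = b then (if y = a then b else if y = b then a else y) else x
    change m (m x y) z = m x (m y z)
    grind

theorem leftZeroMonoid_mul_mem {α : Type*} [DecidableEq α] (a : α) :
    letI := leftZeroMonoid a
    ∀ x y : α, x * y = 1 ∨ x * y = x ∨ x * y = y := by
  intro x y
  let m (x y : α) : α := if x = a then y else x
  change m x y = a ∨ m x y = x ∨ m x y = y
  grind

theorem unitsLeftZeroMonoid_mul_mem {α : Type*} [DecidableEq α] (a b : α) :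
    letI := unitsLeftZeroMonoid a b
    ∀ x y : α, x * y = 1 ∨ x * y = x ∨ x * y = y := by
  intro x y
  let m (x y : α) : α :=
    if x = a then y else if x = b then (if y = a then b else if y = b then a else y) else x
  change m x y = a ∨ m x y = x ∨ m x y = y
  grind

/-- If every product `x * y` lies in `{1, x, y}`, then setwise multiplication of finite sets
containing `1` is union. -/
theorem Finset.mul_eq_union_of_mul_mem {M : Type*} [Monoid M] [DecidableEq M]
    (hM : ∀ x y : M, x * y = 1 ∨ x * y = x ∨ x * y = y) {X Y : Finset M}
    (hX : 1 ∈ X) (hY : 1 ∈ Y) : X * Y = X ∪ Y := by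
  ext z
  rw [Finset.mem_mul, Finset.mem_union]
  constructor
  · rintro ⟨x, hx, y, hy, rfl⟩
    rcases hM x y with h | h | h <;> rw [h] <;> tauto
  · rintro (h | h)
    · exact ⟨z, h, 1, hY, mul_one z⟩
    · exact ⟨1, hX, z, h, one_mul z⟩

/-- Two monoids in which every product `x * y` lies in `{1, x, y}` have isomorphic reduced
finitary power monoids as soon as there is a bijection between them preserving `1`. -/
theorem RFPM1.nonempty_mulEquiv_of_mul_mem {H K : Type*} [Monoid H] [Monoid K]
    [DecidableEq H] [DecidableEq K] (e : H ≃ K) (he : e 1 = 1)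
    (hH : ∀ x y : H, x * y = 1 ∨ x * y = x ∨ x * y = y)
    (hK : ∀ x y : K, x * y = 1 ∨ x * y = x ∨ x * y = y) :
    Nonempty (↥(RFPM1 H) ≃* ↥(RFPM1 K)) := by
  have map_mem (X : Finset H) : X ∈ RFPM1 H ↔ e.finsetCongr X ∈ RFPM1 K := by
    change 1 ∈ X ↔ 1 ∈ X.map e.toEmbedding
    rw [Finset.mem_map_equiv, ← he, e.symm_apply_apply]
  refine ⟨⟨e.finsetCongr.subtypeEquiv map_mem, fun X Y => Subtype.ext ?_⟩⟩
  change (X.1 * Y.1).map e.toEmbedding = X.1.map e.toEmbedding * Y.1.map e.toEmbedding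
  rw [Finset.mul_eq_union_of_mul_mem hH X.2 Y.2, Finset.map_union]
  exact (Finset.mul_eq_union_of_mul_mem hK ((map_mem X.1).1 X.2) ((map_mem Y.1).1 Y.2)).symm

/-- A monoid with a non-idempotent element is not isomorphic to one without. -/
theorem MulEquiv.isEmpty_of_mul_self_ne {H K : Type*} [Monoid H] [Monoid K]
    (hH : ∀ x : H, x * x = x) {b : K} (hb : b * b ≠ b) : IsEmpty (H ≃* K) :=
  ⟨fun f => hb <| f.symm.injective <| by rw [map_mul, hH]⟩

/-- For every cardinal `κ ≥ 2` (finite or infinite), there exist monoids `H` and `K` of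
cardinality `κ` that are not isomorphic but whose reduced finitary power monoids are
isomorphic. -/
theorem exists_nonIso_monoids_with_iso_rfpm (κ : Cardinal.{u}) (hκ : 2 ≤ κ) :
    ∃ (H K : Type u) (iH : Monoid H) (iK : Monoid K)
      (dH : DecidableEq H) (dK : DecidableEq K),
      Cardinal.mk H = κ ∧ Cardinal.mk K = κ ∧
      IsEmpty (H ≃* K) ∧ Nonempty (↥(RFPM1 H) ≃* ↥(RFPM1 K)) := by
  classical
  obtain ⟨α, rfl⟩ : ∃ α : Type u, Cardinal.mk α = κ := ⟨κ.out, κ.mk_out⟩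
  obtain ⟨a, b, hab⟩ := Cardinal.two_le_iff.1 hκ
  refine ⟨α, α, leftZeroMonoid a, unitsLeftZeroMonoid a b, inferInstance, inferInstance,
    rfl, rfl, ?_, ?_⟩
  · refine @MulEquiv.isEmpty_of_mul_self_ne α α (leftZeroMonoid a) (unitsLeftZeroMonoid a b)
      (fun x => ite_self x) b ?_
    change (if b = a then b else if b = b then (if b = a then b else if b = b then a else b)
      else b) ≠ b
    grind
  · exact @RFPM1.nonempty_mulEquiv_of_mul_mem α α (leftZeroMonoid a) (unitsLeftZeroMonoid a b)
      _ _ (Equiv.refl α) rfl (leftZeroMonoid_mul_mem a) (unitsLeftZeroMonoid_mul_mem a b)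
end
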